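/- Geometry of inner parallel sets of a C² domain: there exists δ₀ > 0 such that for every 0 ≤ δ ≤ δ₀ the set Ω_δ = {x ∈ Ω : d(x) > δ} is connected, and any two points x, y ∈ Ω_δ can be joined by a piecewise C¹ path γ : [0,1] → closure(Ω_δ) with γ(0) = x and γ(1) = y; moreover, defining d̃_δ(x,y) as the infimum of ∫₀¹ |γ̇(t)| dt over all such paths, there exists a constant C_Ω > 0 (independent of δ, x, y) with d̃_δ(x,y) ≤ C_Ω for all x, y ∈ Ω_δ, and there exist constants δ̄ > 0 and K̄ > 0 (independent of δ) such that d̃_δ(x,y) ≤ K̄|x−y| whenever x, y ∈ Ω_δ and |x−y| ≤ δ̄. -/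

import Mathlib

open Set Filter Topology Metric MeasureTheory

noncomputable section

/-- Euclidean space `ℝ^N`. -/
abbrev Euc (N : ℕ) : Type := EuclideanSpace ℝ (Fin N)

/-- The Laplacian of `φ` at `x`, computed as the trace of the second derivative
in the standard orthonormal basis of `ℝ^N`. -/
noncomputable def lapl {N : ℕ} (φ : Euc N → ℝ) (x : Euc N) : ℝ :=
  ∑ i : Fin N,
    iteratedFDeriv ℝ 2 φ x ![EuclideanSpace.single i 1, EuclideanSpace.single i 1]

/-- `Ω` is a domain with `C²` boundary: it is the sublevel set of a `C²`
defining function whose gradient does not vanish on the boundary. -/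
def HasC2Boundary {N : ℕ} (Ω : Set (Euc N)) : Prop :=
  ∃ ρ : Euc N → ℝ, ContDiff ℝ 2 ρ ∧ Ω = {x | ρ x < 0} ∧
    frontier Ω = {x | ρ x = 0} ∧ ∀ x ∈ frontier Ω, gradient ρ x ≠ 0

/-- The stationary operator `−Δφ(x) + |Dφ(x)|^m + λ r − h(x)` evaluated with the
value `r` of the (sub/super)solution at `x`. -/
noncomputable def statOp {N : ℕ} (h : Euc N → ℝ) (lam m : ℝ)
    (φ : Euc N → ℝ) (r : ℝ) (x : Euc N) : ℝ :=
  -lapl φ x + ‖gradient φ x‖ ^ m + lam * r - h x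

/-- Viscosity subsolution of the generalized Dirichlet problem
`S(Ω,h,k,λ)`: `−Δw + |Dw|^m + λ w = h` in `Ω`, `w = k` on `∂Ω`. -/
def IsStatSub {N : ℕ} (Ω : Set (Euc N)) (h k : Euc N → ℝ) (lam m : ℝ)
    (u : Euc N → ℝ) : Prop :=
  UpperSemicontinuousOn u (closure Ω) ∧
  ∀ φ : Euc N → ℝ, ContDiff ℝ 2 φ → ∀ x₀ ∈ closure Ω,
    IsLocalMaxOn (u - φ) (closure Ω) x₀ →
      (x₀ ∈ Ω → statOp h lam m φ (u x₀) x₀ ≤ 0) ∧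
      (x₀ ∈ frontier Ω → min (statOp h lam m φ (u x₀) x₀) (u x₀ - k x₀) ≤ 0)

/-- Viscosity supersolution of the generalized Dirichlet problem `S(Ω,h,k,λ)`. -/
def IsStatSuper {N : ℕ} (Ω : Set (Euc N)) (h k : Euc N → ℝ) (lam m : ℝ)
    (v : Euc N → ℝ) : Prop :=
  LowerSemicontinuousOn v (closure Ω) ∧
  ∀ φ : Euc N → ℝ, ContDiff ℝ 2 φ → ∀ x₀ ∈ closure Ω,
    IsLocalMinOn (v - φ) (closure Ω) x₀ →
      (x₀ ∈ Ω → 0 ≤ statOp h lam m φ (v x₀) x₀) ∧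
      (x₀ ∈ frontier Ω → 0 ≤ max (statOp h lam m φ (v x₀) x₀) (v x₀ - k x₀))

/-- The parabolic operator
`φ_t(x,t) − Δφ(·,t)(x) + |Dφ(·,t)(x)|^m + λ r − f(x)`. -/
noncomputable def parOp {N : ℕ} (f : Euc N → ℝ) (lam m : ℝ)
    (φ : Euc N × ℝ → ℝ) (r : ℝ) (x : Euc N) (t : ℝ) : ℝ :=
  deriv (fun s => φ (x, s)) t - lapl (fun y => φ (y, t)) x
    + ‖gradient (fun y => φ (y, t)) x‖ ^ m + lam * r - f x

/-- Viscosity subsolution of the generalized initial-boundary value problem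
`E(Ω,f,g,u₀,λ)` on the time interval `[0,T]`:
`u_t − Δu + |Du|^m + λ u = f` in `Ω × (0,T]`, `u = g` on `∂Ω × (0,T]`,
`u(·,0) = u₀` on `closure Ω`. -/
def IsParSub {N : ℕ} (Ω : Set (Euc N)) (f g u₀ : Euc N → ℝ) (lam m T : ℝ)
    (u : Euc N → ℝ → ℝ) : Prop :=
  UpperSemicontinuousOn (fun p : Euc N × ℝ => u p.1 p.2) (closure Ω ×ˢ Ico 0 T) ∧
  (∀ x ∈ closure Ω, u x 0 ≤ u₀ x) ∧
  ∀ φ : Euc N × ℝ → ℝ, ContDiff ℝ 2 φ → ∀ x₀ : Euc N, ∀ t₀ : ℝ,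
    (x₀, t₀) ∈ closure Ω ×ˢ Ioc 0 T →
    IsLocalMaxOn (fun p : Euc N × ℝ => u p.1 p.2 - φ p) (closure Ω ×ˢ Ioc 0 T) (x₀, t₀) →
      (x₀ ∈ Ω → parOp f lam m φ (u x₀ t₀) x₀ t₀ ≤ 0) ∧
      (x₀ ∈ frontier Ω →
        min (parOp f lam m φ (u x₀ t₀) x₀ t₀) (u x₀ t₀ - g x₀) ≤ 0)

/-- Viscosity supersolution of `E(Ω,f,g,u₀,λ)` on the time interval `[0,T]`. -/
def IsParSuper {N : ℕ} (Ω : Set (Euc N)) (f g u₀ : Euc N → ℝ) (lam m T : ℝ)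
    (v : Euc N → ℝ → ℝ) : Prop :=
  LowerSemicontinuousOn (fun p : Euc N × ℝ => v p.1 p.2) (closure Ω ×ˢ Icc 0 T) ∧
  (∀ x ∈ closure Ω, u₀ x ≤ v x 0) ∧
  ∀ φ : Euc N × ℝ → ℝ, ContDiff ℝ 2 φ → ∀ x₀ : Euc N, ∀ t₀ : ℝ,
    (x₀, t₀) ∈ closure Ω ×ˢ Ioc 0 T →
    IsLocalMinOn (fun p : Euc N × ℝ => v p.1 p.2 - φ p) (closure Ω ×ˢ Ioc 0 T) (x₀, t₀) →
      (x₀ ∈ Ω → 0 ≤ parOp f lam m φ (v x₀ t₀) x₀ t₀) ∧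
      (x₀ ∈ frontier Ω →
        0 ≤ max (parOp f lam m φ (v x₀ t₀) x₀ t₀) (v x₀ t₀ - g x₀))

/-- A continuous viscosity solution, global in time, of `E(Ω,f,g,u₀,λ)`. -/
def IsGlobalParSol {N : ℕ} (Ω : Set (Euc N)) (f g u₀ : Euc N → ℝ) (lam m : ℝ)
    (u : Euc N → ℝ → ℝ) : Prop :=
  ContinuousOn (fun p : Euc N × ℝ => u p.1 p.2) (closure Ω ×ˢ Ici 0) ∧
  ∀ T > (0 : ℝ), IsParSub Ω f g u₀ lam m T u ∧ IsParSuper Ω f g u₀ lam m T u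

open scoped Classical in
/-- Redefinition of a parabolic subsolution on the lateral boundary by its
`limsup` from inside `Ω × (0,T]`. -/
noncomputable def uscExtPar {N : ℕ} (Ω : Set (Euc N)) (T : ℝ)
    (u : Euc N → ℝ → ℝ) : Euc N → ℝ → ℝ :=
  fun z t => if z ∈ Ω then u z t
    else limsup (fun p : Euc N × ℝ => u p.1 p.2) (𝓝[Ω ×ˢ Ioc 0 T] (z, t))

open scoped Classical in
/-- Redefinition of a stationary subsolution on the boundary by its `limsup`
from inside `Ω`. -/
noncomputable def uscExtStat {N : ℕ} (Ω : Set (Euc N))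
    (u : Euc N → ℝ) : Euc N → ℝ :=
  fun z => if z ∈ Ω then u z else limsup u (𝓝[Ω] z)

/-- Continuous viscosity solution of the state constraint problem
`−Δw + |Dw|^m + λ w = h` in `Ω`, `−Δw + |Dw|^m + λ w ≥ h` on `∂Ω`. -/
def IsSCSolution {N : ℕ} (Ω : Set (Euc N)) (h : Euc N → ℝ) (lam m : ℝ)
    (w : Euc N → ℝ) : Prop :=
  ContinuousOn w (closure Ω) ∧
  (∀ φ : Euc N → ℝ, ContDiff ℝ 2 φ → ∀ x₀ ∈ Ω, IsLocalMaxOn (w - φ) Ω x₀ →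
      statOp h lam m φ (w x₀) x₀ ≤ 0) ∧
  (∀ φ : Euc N → ℝ, ContDiff ℝ 2 φ → ∀ x₀ ∈ closure Ω,
      IsLocalMinOn (w - φ) (closure Ω) x₀ → 0 ≤ statOp h lam m φ (w x₀) x₀)

/-- Continuous viscosity subsolution of `−Δu + |Du|^m ≤ h` in `Ω`
(no boundary condition). -/
def IsIntSub {N : ℕ} (Ω : Set (Euc N)) (h : Euc N → ℝ) (m : ℝ)
    (u : Euc N → ℝ) : Prop :=
  ∀ φ : Euc N → ℝ, ContDiff ℝ 2 φ → ∀ x₀ ∈ Ω, IsLocalMaxOn (u - φ) Ω x₀ →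
    statOp h 0 m φ (u x₀) x₀ ≤ 0

/-- Hölder continuity with exponent `α` on a set. -/
def HolderOnCl {N : ℕ} (α : ℝ) (s : Set (Euc N)) (w : Euc N → ℝ) : Prop :=
  ∃ C > (0 : ℝ), ∀ x ∈ s, ∀ y ∈ s, |w x - w y| ≤ C * ‖x - y‖ ^ α

/-- Local Lipschitz continuity inside `Ω`. -/
def LocLipIn {N : ℕ} (Ω : Set (Euc N)) (w : Euc N → ℝ) : Prop :=
  ∀ x ∈ Ω, ∃ ε > (0 : ℝ), ∃ K : ℝ, 0 ≤ K ∧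
    ∀ y ∈ ball x ε ∩ Ω, ∀ z ∈ ball x ε ∩ Ω, |w y - w z| ≤ K * ‖y - z‖

/-- A piecewise `C¹` path parametrized on `[0,1]`. -/
def IsPWC1Path {N : ℕ} (γ : ℝ → Euc N) : Prop :=
  ContinuousOn γ (Icc 0 1) ∧
  ∃ n : ℕ, ∃ τ : Fin (n + 1) → ℝ, StrictMono τ ∧ τ 0 = 0 ∧ τ (Fin.last n) = 1 ∧
    ∀ i : Fin n, ContDiffOn ℝ 1 γ (Icc (τ i.castSucc) (τ i.succ))

/-- The length of a path on `[0,1]`. -/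
noncomputable def pathLen {N : ℕ} (γ : ℝ → Euc N) : ℝ :=
  ∫ t in (0 : ℝ)..1, ‖derivWithin γ (Icc (0 : ℝ) 1) t‖

/-- The geodesic-type distance inside `closure S` via piecewise `C¹` paths. -/
noncomputable def dTilde {N : ℕ} (S : Set (Euc N)) (x y : Euc N) : ℝ :=
  sInf {L : ℝ | ∃ γ : ℝ → Euc N, IsPWC1Path γ ∧ γ 0 = x ∧ γ 1 = y ∧
    MapsTo γ (Icc 0 1) (closure S) ∧ L = pathLen γ}

/-- The inner parallel set `Ω_δ = {x ∈ Ω : dist(x,∂Ω) > δ}`. -/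
def innerSet {N : ℕ} (Ω : Set (Euc N)) (δ : ℝ) : Set (Euc N) :=
  {x ∈ Ω | δ < infDist x (frontier Ω)}

end

theorem aux_ball_subset {N : ℕ} {Ω : Set (Euc N)} {x : Euc N} (hx : x ∈ Ω) :
    ball x (infDist x (frontier Ω)) ⊆ Ω := by
  intro y hy
  by_contra hyΩ
  have hpc : IsPreconnected (segment ℝ x y) := (convex_segment x y).isPreconnected
  have h1 : (segment ℝ x y ∩ frontier Ω).Nonempty := by
    by_contra hne
    rw [not_nonempty_iff_eq_empty] at hne
    have := hpc.subset_of_closure_inter_subset (u := interior Ω) isOpen_interior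
      ⟨x, left_mem_segment ℝ x y, by
        by_contra hxi
        have : x ∈ segment ℝ x y ∩ frontier Ω :=
          ⟨left_mem_segment ℝ x y, subset_closure hx, hxi⟩
        rw [hne] at this
        exact this⟩
      (by
        rintro z ⟨hz, hzs⟩
        by_contra hzi
        have : z ∈ segment ℝ x y ∩ frontier Ω :=
          ⟨hzs, closure_mono interior_subset hz, hzi⟩
        rw [hne] at this
        exact this)
    exact hyΩ (interior_subset (this (right_mem_segment ℝ x y)))
  obtain ⟨z, hz, hzf⟩ := h1
  have h2 := infDist_le_dist_of_mem (x := x) hzf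
  have h3 := segment_subset_closedBall_left x y hz
  rw [mem_closedBall, dist_comm] at h3
  rw [mem_ball, dist_comm] at hy
  linarith

theorem aux_le_infDist {N : ℕ} {Ω : Set (Euc N)} (hΩo : IsOpen Ω)
    (hne : (frontier Ω).Nonempty) {x : Euc N} {s : ℝ} (h : ball x s ⊆ Ω) :
    s ≤ infDist x (frontier Ω) := by
  rw [le_infDist hne]
  intro y hy
  by_contra hlt
  push Not at hlt
  have : y ∈ Ω := h (by rwa [mem_ball, dist_comm])
  rw [hΩo.frontier_eq] at hy
  exact hy.2 this

/-- points near a point of the inner set -/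
theorem aux_near {N : ℕ} {Ω : Set (Euc N)} {x q : Euc N} (hx : x ∈ Ω) {δ h : ℝ} (hδ : 0 ≤ δ)
    (hd : δ + h < infDist x (frontier Ω)) (hq : dist q x ≤ h) : q ∈ innerSet Ω δ := by
  refine ⟨aux_ball_subset hx (by rw [mem_ball]; linarith), ?_⟩
  have := infDist_le_infDist_add_dist (s := frontier Ω) (x := x) (y := q)
  rw [dist_comm] at this
  linarith

theorem aux_cone {N : ℕ} {Ω : Set (Euc N)} (hΩ2 : HasC2Boundary Ω) {p : Euc N}
    (hp : p ∈ frontier Ω) :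
    ∃ v : Euc N, ‖v‖ ≤ 1 ∧ ∃ r > (0 : ℝ), ∃ c > (0 : ℝ), ∀ z ∈ Ω, dist z p < r →
      ∀ t, 0 ≤ t → t ≤ r → ∀ w, ‖w - v‖ ≤ c → z + t • w ∈ Ω := by
  obtain ⟨ρ, hρ, rfl, hf, hg⟩ := hΩ2
  have hstr : HasStrictFDerivAt ρ (fderiv ℝ ρ p) p := hρ.contDiffAt.hasStrictFDerivAt (by norm_num)
  set A := fderiv ℝ ρ p with hA
  set u := gradient ρ p with hu
  have hu0 : u ≠ 0 := hg p hp
  have hAu : A u = ‖u‖ ^ 2 := by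
    have : A = (InnerProductSpace.toDual ℝ (Euc N)) u := by
      simp [hu, hA, gradient]
    rw [this]
    simp
  have hun : 0 < ‖u‖ := norm_pos_iff.2 hu0
  set v : Euc N := -(‖u‖⁻¹ • u) with hv
  have hvn : ‖v‖ = 1 := by
    rw [hv, norm_neg, norm_smul]
    simp [hun.ne']
  have hAv : A v = -‖u‖ := by
    rw [hv, map_neg, map_smul, hAu]
    simp only [smul_eq_mul]
    field_simp
  set a := ‖u‖ with ha
  set c := min 1 (a / (2 * (‖A‖ + 1))) with hc
  have hA0 : 0 ≤ ‖A‖ := norm_nonneg _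
  have hcpos : 0 < c := by rw [hc]; positivity
  have hc1 : c ≤ 1 := min_le_left _ _
  have hcA : ‖A‖ * c ≤ a / 2 := by
    have h1 : c ≤ a / (2 * (‖A‖ + 1)) := min_le_right _ _
    rw [le_div_iff₀ (by positivity)] at h1
    nlinarith
  have hlo := (hasStrictFDerivAt_iff_isLittleO.1 hstr).def (c := a / 4) (by positivity)
  obtain ⟨ε, hε, hball⟩ := Metric.eventually_nhds_iff.1 hlo
  refine ⟨v, hvn.le, ε / 4, by positivity, c, hcpos, ?_⟩
  intro z hz hzp t ht htr w hw
  have hwn : ‖w‖ ≤ 2 := by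
    calc ‖w‖ = ‖(w - v) + v‖ := by simp
      _ ≤ ‖w - v‖ + ‖v‖ := norm_add_le _ _
      _ ≤ 2 := by linarith
  have htw : ‖t • w‖ ≤ t * 2 := by
    rw [norm_smul, Real.norm_of_nonneg ht]
    gcongr
  have h1 : dist (z + t • w) p < ε := by
    calc dist (z + t • w) p ≤ dist (z + t • w) z + dist z p := dist_triangle _ _ _
      _ = ‖t • w‖ + dist z p := by simp [dist_eq_norm]
      _ < ε := by linarith
  have h2 := @hball (z + t • w, z) (by
    rw [Prod.dist_eq]
    exact max_lt h1 (by linarith))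
  simp only [add_sub_cancel_left] at h2
  have hAw : A w ≤ -a / 2 := by
    have h3 : A w = A v + A (w - v) := by simp
    have h4 : ‖A (w - v)‖ ≤ ‖A‖ * c := (A.le_opNorm _).trans (by gcongr)
    have h5 := (Real.norm_eq_abs (A (w - v)) ▸ le_abs_self (A (w - v)))
    linarith
  rw [map_smul, smul_eq_mul, Real.norm_eq_abs] at h2
  have h6 := le_abs_self (ρ (z + t • w) - ρ z - t * A w)
  have h7 : a / 4 * ‖t • w‖ ≤ a / 4 * (t * 2) := by gcongr
  have h8 : t * A w ≤ t * (-a / 2) := by gcongr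
  have hz' : ρ z < 0 := hz
  change ρ (z + t • w) < 0
  nlinarith

theorem aux_push {N : ℕ} {Ω : Set (Euc N)} (hΩo : IsOpen Ω) (hΩ2 : HasC2Boundary Ω) {p : Euc N}
    (hp : p ∈ frontier Ω) :
    ∃ r > (0 : ℝ), ∃ c > (0 : ℝ), ∃ v : Euc N, ‖v‖ ≤ 1 ∧ ∀ x ∈ Ω, dist x p < r →
      ∀ t, 0 ≤ t → t ≤ r → x + t • v ∈ Ω ∧
        infDist x (frontier Ω) + c * t ≤ infDist (x + t • v) (frontier Ω) := by
  obtain ⟨v, hv, r, hr, c, hc, H⟩ := aux_cone hΩ2 hp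
  refine ⟨r / 3, by positivity, c, hc, v, hv, ?_⟩
  intro x hx hxp t ht htr
  refine ⟨H x hx (by linarith) t ht (by linarith) v (by simpa using hc.le), ?_⟩
  apply aux_le_infDist hΩo ⟨p, hp⟩
  intro q hq
  have hsle : infDist x (frontier Ω) ≤ dist x p := infDist_le_dist_of_mem hp
  have hsub := aux_ball_subset hx
  have hs0 : 0 < infDist x (frontier Ω) := by
    have hcl : IsClosed (frontier Ω) := isClosed_frontier
    rw [← hcl.notMem_iff_infDist_pos ⟨p, hp⟩, hΩo.frontier_eq]
    exact fun h => h.2 hx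
  set s := infDist x (frontier Ω) with hs
  have hpos : 0 < s + c * t := by positivity
  set u := q - (x + t • v) with hu
  have hun : ‖u‖ < s + c * t := by rwa [mem_ball, dist_eq_norm] at hq
  have hq' : q = (x + (s / (s + c * t)) • u) + t • (v + (c / (s + c * t)) • u) := by
    have h1 : (s / (s + c * t)) • u + (t * (c / (s + c * t))) • u = u := by
      rw [← add_smul]
      have : s / (s + c * t) + t * (c / (s + c * t)) = 1 := by field_simp
      rw [this, one_smul]
    rw [smul_add, smul_smul]
    calc q = x + t • v + u := by rw [hu]; abel
      _ = x + t • v + ((s / (s + c * t)) • u + (t * (c / (s + c * t))) • u) := by rw [h1]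
      _ = _ := by abel
  have hz : ‖(s / (s + c * t)) • u‖ < s := by
    rw [norm_smul, Real.norm_of_nonneg (by positivity), div_mul_eq_mul_div,
      div_lt_iff₀ hpos]
    gcongr
  rw [hq']
  apply H
  · apply hsub
    rw [mem_ball, dist_eq_norm]
    simpa using hz
  · calc dist (x + (s / (s + c * t)) • u) p ≤ dist (x + (s / (s + c * t)) • u) x + dist x p :=
          dist_triangle _ _ _
      _ = ‖(s / (s + c * t)) • u‖ + dist x p := by simp [dist_eq_norm]
      _ < r := by linarith
  · exact ht
  · linarith
  · rw [add_sub_cancel_left, norm_smul, Real.norm_of_nonneg (by positivity), div_mul_eq_mul_div,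
      div_le_iff₀ hpos]
    gcongr

theorem aux_push_unif {N : ℕ} {Ω : Set (Euc N)} (hΩo : IsOpen Ω)
    (hΩb : Bornology.IsBounded Ω) (hne : (frontier Ω).Nonempty) (hΩ2 : HasC2Boundary Ω) :
    ∃ r > (0 : ℝ), ∃ c > (0 : ℝ), c ≤ 1 ∧ ∀ x, infDist x (frontier Ω) < r →
      ∃ v : Euc N, ‖v‖ ≤ 1 ∧ ∀ y ∈ Ω, dist y x < r →
      ∀ t, 0 ≤ t → t ≤ r → y + t • v ∈ Ω ∧
        infDist y (frontier Ω) + c * t ≤ infDist (y + t • v) (frontier Ω) := by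
  have hK : IsCompact (frontier Ω) :=
    Metric.isCompact_of_isClosed_isBounded isClosed_frontier
      (hΩb.closure.subset frontier_subset_closure)
  have key : ∃ r > (0 : ℝ), ∃ c > (0 : ℝ), ∀ p ∈ frontier Ω,
      ∃ v : Euc N, ‖v‖ ≤ 1 ∧ ∀ y ∈ Ω, dist y p < r →
      ∀ t, 0 ≤ t → t ≤ r → y + t • v ∈ Ω ∧
        infDist y (frontier Ω) + c * t ≤ infDist (y + t • v) (frontier Ω) := by
    refine hK.induction_on (p := fun s => ∃ r > (0 : ℝ), ∃ c > (0 : ℝ), ∀ p ∈ s,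
      ∃ v : Euc N, ‖v‖ ≤ 1 ∧ ∀ y ∈ Ω, dist y p < r →
      ∀ t, 0 ≤ t → t ≤ r → y + t • v ∈ Ω ∧
        infDist y (frontier Ω) + c * t ≤ infDist (y + t • v) (frontier Ω)) ?_ ?_ ?_ ?_
    · exact ⟨1, one_pos, 1, one_pos, by simp⟩
    · rintro s t hst ⟨r, hr, c, hc, h⟩
      exact ⟨r, hr, c, hc, fun p hp => h p (hst hp)⟩
    · rintro s t ⟨r, hr, c, hc, h⟩ ⟨r', hr', c', hc', h'⟩
      refine ⟨min r r', lt_min hr hr', min c c', lt_min hc hc', ?_⟩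
      have m1 := min_le_left r r'
      have m2 := min_le_right r r'
      have m3 := min_le_left c c'
      have m4 := min_le_right c c'
      rintro p (hp | hp)
      · obtain ⟨v, hv, H⟩ := h p hp
        refine ⟨v, hv, fun y hy hyp t ht htr => ?_⟩
        obtain ⟨h1, h2⟩ := H y hy (by linarith) t ht (by linarith)
        exact ⟨h1, by nlinarith⟩
      · obtain ⟨v, hv, H⟩ := h' p hp
        refine ⟨v, hv, fun y hy hyp t ht htr => ?_⟩
        obtain ⟨h1, h2⟩ := H y hy (by linarith) t ht (by linarith)
        exact ⟨h1, by nlinarith⟩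
    · intro p hp
      obtain ⟨r, hr, c, hc, v, hv, H⟩ := aux_push hΩo hΩ2 hp
      refine ⟨ball p (r / 2), mem_nhdsWithin_of_mem_nhds (ball_mem_nhds _ (by positivity)),
        r / 2, by positivity, c, hc, fun p' hp' => ⟨v, hv, fun y hy hyp t ht htr => ?_⟩⟩
      rw [mem_ball] at hp'
      exact H y hy (by linarith [dist_triangle y p' p]) t ht (by linarith)
  obtain ⟨r, hr, c, hc, h⟩ := key
  refine ⟨r / 2, by positivity, min c 1, lt_min hc one_pos, min_le_right _ _, fun x hx => ?_⟩
  obtain ⟨p, hp, hxp⟩ := (infDist_lt_iff hne).1 hx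
  obtain ⟨v, hv, H⟩ := h p hp
  refine ⟨v, hv, fun y hy hyp t ht htr => ?_⟩
  obtain ⟨h1, h2⟩ := H y hy (by linarith [dist_triangle y x p]) t ht (by linarith)
  exact ⟨h1, by nlinarith [min_le_left c 1]⟩

/-- polygonal chain with `n` segments of length at most `D` inside `S` -/
inductive SegChain {N : ℕ} (S : Set (Euc N)) (D : ℝ) : ℕ → Euc N → Euc N → Prop
  | nil (x : Euc N) (hx : x ∈ S) : SegChain S D 0 x x
  | snoc (n : ℕ) (x y z : Euc N) (h : SegChain S D n x y) (hs : segment ℝ y z ⊆ S)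
      (hd : dist y z ≤ D) : SegChain S D (n + 1) x z

theorem SegChain.left_mem {N : ℕ} {S : Set (Euc N)} {D : ℝ} {n : ℕ} {x y : Euc N}
    (h : SegChain S D n x y) : x ∈ S := by
  induction h with
  | nil x hx => exact hx
  | snoc n x y z h hs hd ih => exact ih

theorem SegChain.right_mem {N : ℕ} {S : Set (Euc N)} {D : ℝ} {n : ℕ} {x y : Euc N}
    (h : SegChain S D n x y) : y ∈ S := by
  cases h with
  | nil x hx => exact hx
  | snoc n x y z h hs hd => exact hs (right_mem_segment ℝ _ _)

theorem SegChain.mono {N : ℕ} {S S' : Set (Euc N)} {D D' : ℝ} {n : ℕ} {x y : Euc N}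
    (h : SegChain S D n x y) (hS : S ⊆ S') (hD : D ≤ D') : SegChain S' D' n x y := by
  induction h with
  | nil x hx => exact .nil x (hS hx)
  | snoc n x y z h hs hd ih => exact .snoc n x y z ih (hs.trans hS) (hd.trans hD)

theorem SegChain.trans {N : ℕ} {S : Set (Euc N)} {D : ℝ} {n m : ℕ} {x y z : Euc N}
    (h : SegChain S D n x y) (h' : SegChain S D m y z) : SegChain S D (n + m) x z := by
  induction h' with
  | nil x hx => exact h
  | snoc m y z w h' hs hd ih => exact .snoc (n + m) _ _ _ (ih h) hs hd

theorem SegChain.single {N : ℕ} {S : Set (Euc N)} {D : ℝ} {x y : Euc N}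
    (hs : segment ℝ x y ⊆ S) (hd : dist x y ≤ D) : SegChain S D 1 x y :=
  .snoc 0 x x y (.nil x (hs (left_mem_segment ℝ _ _))) hs hd

theorem SegChain.symm {N : ℕ} {S : Set (Euc N)} {D : ℝ} {n : ℕ} {x y : Euc N}
    (h : SegChain S D n x y) : SegChain S D n y x := by
  induction h with
  | nil x hx => exact .nil x hx
  | snoc n x y z h hs hd ih =>
    rw [add_comm]
    exact (SegChain.single (by rwa [segment_symm]) (by rwa [dist_comm])).trans ih

theorem SegChain.pad {N : ℕ} {S : Set (Euc N)} {D : ℝ} (hD : 0 ≤ D) {n m : ℕ} {x y : Euc N}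
    (h : SegChain S D n x y) (hnm : n ≤ m) : SegChain S D m x y := by
  induction hnm with
  | refl => exact h
  | step _ ih =>
    exact .snoc _ _ _ _ ih (by simpa using h.right_mem) (by simpa using hD)

theorem SegChain.joinedIn {N : ℕ} {S : Set (Euc N)} {D : ℝ} {n : ℕ} {x y : Euc N}
    (h : SegChain S D n x y) : JoinedIn S x y := by
  induction h with
  | nil x hx => exact JoinedIn.refl hx
  | snoc n x y z h hs hd ih => exact ih.trans (JoinedIn.of_segment_subset hs)

theorem SegChain.exists_path {N : ℕ} {S : Set (Euc N)} {D : ℝ} (hD : 0 ≤ D) {n : ℕ}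
    {x y : Euc N} (h : SegChain S D n x y) :
    ∃ γ : ℝ → Euc N, IsPWC1Path γ ∧ γ 0 = x ∧ γ 1 = y ∧ MapsTo γ (Icc 0 1) S ∧
      LipschitzOnWith (Real.toNNReal (2 ^ n * D)) γ (Icc 0 1) := by
  suffices H : ∃ γ : ℝ → Euc N, (∃ n : ℕ, ∃ τ : Fin (n + 1) → ℝ, StrictMono τ ∧ τ 0 = 0 ∧
      τ (Fin.last n) = 1 ∧ ∀ i : Fin n, ContDiffOn ℝ 1 γ (Icc (τ i.castSucc) (τ i.succ))) ∧
      γ 0 = x ∧ γ 1 = y ∧ MapsTo γ (Icc 0 1) S ∧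
      ∀ s t, 0 ≤ s → s ≤ t → t ≤ 1 → dist (γ s) (γ t) ≤ 2 ^ n * D * (t - s) by
    obtain ⟨γ, h1, h2, h3, h4, h5⟩ := H
    have hL : LipschitzOnWith (Real.toNNReal (2 ^ n * D)) γ (Icc 0 1) := by
      apply LipschitzOnWith.of_dist_le_mul
      intro s hs t ht
      rw [Real.coe_toNNReal _ (by positivity)]
      rcases le_total s t with hst | hst
      · rw [Real.dist_eq, abs_sub_comm, abs_of_nonneg (by linarith)]
        exact h5 s t hs.1 hst ht.2
      · rw [Real.dist_eq, abs_of_nonneg (by linarith), dist_comm]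
        exact h5 t s ht.1 hst hs.2
    exact ⟨γ, ⟨hL.continuousOn, h1⟩, h2, h3, h4, hL⟩
  induction h with
  | nil x hx =>
    refine ⟨fun _ => x, ⟨1, fun i => (i : ℝ), ?_, ?_, ?_, ?_⟩, rfl, rfl, fun _ _ => hx, ?_⟩
    · intro i j hij
      change ((i : ℕ) : ℝ) < ((j : ℕ) : ℝ)
      exact_mod_cast hij
    · simp
    · simp
    · intro i
      exact contDiffOn_const
    · intro s t h0 hst h1
      have : 0 ≤ t - s := by linarith
      simp only [dist_self]
      positivity
  | snoc n x y z h hs hd ih =>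
    obtain ⟨γ, ⟨k, τ, hτ, hτ0, hτ1, hτd⟩, h0, h1, hm, hlip⟩ := ih
    set g : ℝ → Euc N := fun t => if t ≤ 1 / 2 then γ (2 * t) else
      AffineMap.lineMap y z (2 * t - 1) with hg
    have hgl : ∀ t, t ≤ 1 / 2 → g t = γ (2 * t) := fun t ht => by simp only [hg]; rw [if_pos ht]
    have hgr : ∀ t, 1 / 2 ≤ t → g t = AffineMap.lineMap y z (2 * t - 1) := fun t ht => by
      simp only [hg]
      split_ifs with h'
      · have : t = 1 / 2 := le_antisymm h' ht
        subst this
        norm_num [h1]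
      · rfl
    have hτle : ∀ i, τ i ≤ 1 := fun i => hτ1 ▸ hτ.monotone (Fin.le_last i)
    have hτge : ∀ i, 0 ≤ τ i := fun i => hτ0 ▸ hτ.monotone (Fin.zero_le i)
    refine ⟨g, ⟨k + 1, Fin.snoc (fun i => τ i / 2) 1, ?_, ?_, ?_, ?_⟩, ?_, ?_, ?_, ?_⟩
    · rw [Fin.strictMono_iff_lt_succ]
      intro i
      refine Fin.lastCases ?_ (fun j => ?_) i
      · rw [Fin.snoc_castSucc, Fin.succ_last, Fin.snoc_last, hτ1]
        norm_num
      · rw [Fin.snoc_castSucc, Fin.succ_castSucc, Fin.snoc_castSucc]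
        have := hτ (Fin.castSucc_lt_succ (i := j))
        linarith
    · have : (0 : Fin (k + 1 + 1)) = Fin.castSucc 0 := rfl
      rw [this, Fin.snoc_castSucc, hτ0]
      simp
    · rw [Fin.snoc_last]
    · intro i
      refine Fin.lastCases ?_ (fun j => ?_) i
      · rw [Fin.snoc_castSucc, Fin.succ_last, Fin.snoc_last, hτ1]
        refine ContDiffOn.congr (f := fun t => AffineMap.lineMap y z (2 * t - 1)) ?_
          (fun t ht => hgr t ht.1)
        simp only [AffineMap.lineMap_apply_module]
        apply ContDiff.contDiffOn
        fun_prop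
      · rw [Fin.snoc_castSucc, Fin.succ_castSucc, Fin.snoc_castSucc]
        refine ContDiffOn.congr (f := fun t => γ (2 * t)) ?_
          (fun t ht => hgl t (by linarith [ht.2, hτle j.succ]))
        refine (hτd j).comp (by fun_prop) ?_
        rintro t ⟨ha, hb⟩
        constructor <;> linarith
    · rw [hgl 0 (by norm_num)]
      simpa using h0
    · rw [hgr 1 (by norm_num)]
      norm_num
    · rintro t ⟨ha, hb⟩
      rcases le_total t (1 / 2) with ht | ht
      · rw [hgl t ht]
        exact hm ⟨by linarith, by linarith⟩
      · rw [hgr t ht]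
        apply hs
        rw [segment_eq_image_lineMap]
        exact ⟨_, ⟨by linarith, by linarith⟩, rfl⟩
    · have hl : ∀ s t, 0 ≤ s → s ≤ t → t ≤ 1 / 2 →
          dist (g s) (g t) ≤ 2 ^ (n + 1) * D * (t - s) := by
        intro s t ha hb hc
        rw [hgl s (by linarith), hgl t hc]
        refine (hlip (2 * s) (2 * t) (by linarith) (by linarith) (by linarith)).trans (le_of_eq ?_)
        ring
      have hr : ∀ s t, 1 / 2 ≤ s → s ≤ t →
          dist (g s) (g t) ≤ 2 ^ (n + 1) * D * (t - s) := by
        intro s t ha hb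
        rw [hgr s ha, hgr t (by linarith), dist_lineMap_lineMap, Real.dist_eq, abs_sub_comm,
          abs_of_nonneg (by linarith)]
        have hp : (1 : ℝ) ≤ 2 ^ n := one_le_pow₀ (by norm_num)
        have hts : 0 ≤ t - s := by linarith
        calc (2 * t - 1 - (2 * s - 1)) * dist y z = 2 * (t - s) * dist y z := by ring
          _ ≤ 2 * (t - s) * (2 ^ n * D) := by
            gcongr
            nlinarith
          _ = _ := by ring
      intro s t ha hb hc
      rcases le_total t (1 / 2) with ht | ht
      · exact hl s t ha hb ht
      rcases le_total s (1 / 2) with hs' | hs'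
      · have e1 := hl s (1 / 2) ha hs' le_rfl
        have e2 := hr (1 / 2) t le_rfl ht
        have e3 := dist_triangle (g s) (g (1 / 2)) (g t)
        linarith
      · exact hr s t hs' hb

theorem pathLen_le {N : ℕ} {γ : ℝ → Euc N} {L : ℝ} (hL : 0 ≤ L)
    (h : LipschitzOnWith (Real.toNNReal L) γ (Icc 0 1)) : pathLen γ ≤ L := by
  have h1 : ∀ᵐ t : ℝ, t ∈ uIoc (0 : ℝ) 1 → ‖‖derivWithin γ (Icc (0 : ℝ) 1) t‖‖ ≤ L := by
    have : ∀ᵐ t : ℝ, t ≠ 1 := by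
      simp [ae_iff]
    filter_upwards [this] with t ht hti
    rw [uIoc_of_le zero_le_one] at hti
    have hmem : Icc (0 : ℝ) 1 ∈ 𝓝 t := Icc_mem_nhds hti.1 (lt_of_le_of_ne hti.2 ht)
    rw [norm_norm, derivWithin_of_mem_nhds hmem]
    have := norm_deriv_le_of_lipschitzOn hmem h
    rwa [Real.coe_toNNReal _ hL] at this
  have h2 := intervalIntegral.norm_integral_le_of_norm_le_const_ae h1
  have h3 := le_abs_self (pathLen γ)
  rw [← Real.norm_eq_abs] at h3
  unfold pathLen at *
  simp only [sub_zero, abs_one, mul_one] at h2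
  exact h3.trans h2

theorem SegChain.dTilde_le {N : ℕ} {S : Set (Euc N)} {D : ℝ} (hD : 0 ≤ D) {n : ℕ}
    {x y : Euc N} (h : SegChain S D n x y) : dTilde S x y ≤ 2 ^ n * D := by
  obtain ⟨γ, h1, h2, h3, h4, h5⟩ := h.exists_path hD
  have hmem : pathLen γ ∈ {L : ℝ | ∃ γ : ℝ → Euc N, IsPWC1Path γ ∧ γ 0 = x ∧ γ 1 = y ∧
      MapsTo γ (Icc 0 1) (closure S) ∧ L = pathLen γ} :=
    ⟨γ, h1, h2, h3, fun t ht => subset_closure (h4 ht), rfl⟩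
  refine (csInf_le ⟨0, ?_⟩ hmem).trans (pathLen_le (by positivity) h5)
  rintro L ⟨γ', -, -, -, -, rfl⟩
  exact intervalIntegral.integral_nonneg zero_le_one (fun _ _ => norm_nonneg _)

theorem aux_anti {N : ℕ} {Ω : Set (Euc N)} {a b : ℝ} (h : a ≤ b) :
    innerSet Ω b ⊆ innerSet Ω a := fun _ hz => ⟨hz.1, lt_of_le_of_lt h hz.2⟩

theorem aux_seg {N : ℕ} {Ω : Set (Euc N)} {δ c T : ℝ} (hc : 0 ≤ c) {x v : Euc N}
    (hx : x ∈ innerSet Ω δ) (hT : 0 ≤ T)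
    (H : ∀ t, 0 ≤ t → t ≤ T → x + t • v ∈ Ω ∧
        infDist x (frontier Ω) + c * t ≤ infDist (x + t • v) (frontier Ω)) :
    segment ℝ x (x + T • v) ⊆ innerSet Ω δ := by
  rw [segment_eq_image']
  rintro _ ⟨θ, ⟨h0, h1⟩, rfl⟩
  have e : x + θ • (x + T • v - x) = x + (θ * T) • v := by
    rw [add_sub_cancel_left, smul_smul]
  have h2 := H (θ * T) (by positivity) (by nlinarith)
  have h3 : 0 ≤ c * (θ * T) := by positivity
  simp only [e]
  exact ⟨h2.1, by linarith [h2.2, hx.2]⟩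

theorem aux_extend {N : ℕ} {Ω : Set (Euc N)} {x₀ a : Euc N} {m D : ℝ} {n : ℕ} (hm : 0 < m)
    (hD : 0 ≤ D) (h : SegChain (innerSet Ω m) D n x₀ a) :
    ∃ m' D' : ℝ, ∃ n' : ℕ, 0 < m' ∧ 0 ≤ D' ∧ ∀ q, dist q a < infDist a (frontier Ω) / 2 →
      SegChain (innerSet Ω m') D' n' x₀ q := by
  have ha := h.right_mem
  have hd : 0 < infDist a (frontier Ω) := hm.trans ha.2
  set d := infDist a (frontier Ω) with hdd
  refine ⟨min m (d / 4), max D d, n + 1, by positivity, le_max_of_le_left hD, fun q hq => ?_⟩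
  have m1 := min_le_left m (d / 4)
  have m2 := min_le_right m (d / 4)
  refine (h.mono (aux_anti (by assumption)) (le_max_left _ _)).trans
    (SegChain.single ?_ ?_)
  · intro z hz
    have := segment_subset_closedBall_left _ _ hz
    rw [mem_closedBall, dist_comm a q] at this
    exact aux_near ha.1 (h := d / 2) (by positivity) (by linarith) (by linarith)
  · rw [dist_comm]
    exact le_trans (by linarith) (le_max_right _ _)

theorem aux_global {N : ℕ} {Ω : Set (Euc N)} (hΩo : IsOpen Ω) (hΩb : Bornology.IsBounded Ω)
    (hΩc : IsConnected Ω) (hne : (frontier Ω).Nonempty) {η : ℝ} (hη : 0 < η) :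
    ∃ x₀ : Euc N, ∃ m D : ℝ, ∃ n : ℕ, 0 < m ∧ 0 ≤ D ∧ ∀ x ∈ Ω, η ≤ infDist x (frontier Ω) →
      SegChain (innerSet Ω m) D n x₀ x := by
  have hcl : IsClosed (frontier Ω) := isClosed_frontier
  have hpos : ∀ z ∈ Ω, 0 < infDist z (frontier Ω) := by
    intro z hz
    rw [← hcl.notMem_iff_infDist_pos hne, hΩo.frontier_eq]
    exact fun h => h.2 hz
  obtain ⟨x₀, hx₀⟩ := hΩc.nonempty
  set A : Set (Euc N) := {x | ∃ m D : ℝ, ∃ n : ℕ, 0 < m ∧ 0 ≤ D ∧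
    SegChain (innerSet Ω m) D n x₀ x} with hA
  have hAΩ : ∀ a ∈ A, a ∈ Ω := by
    rintro a ⟨m, D, n, hm, hD, h⟩
    exact h.right_mem.1
  have hext : ∀ a ∈ A, ∀ q, dist q a < infDist a (frontier Ω) / 2 → q ∈ A := by
    rintro a ⟨m, D, n, hm, hD, h⟩ q hq
    obtain ⟨m', D', n', hm', hD', h'⟩ := aux_extend hm hD h
    exact ⟨m', D', n', hm', hD', h' q hq⟩
  have hsub : Ω ⊆ A := by
    apply hΩc.isPreconnected.subset_of_closure_inter_subset
    · rw [Metric.isOpen_iff]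
      intro a ha
      exact ⟨infDist a (frontier Ω) / 2, half_pos (hpos a (hAΩ a ha)), fun q hq => hext a ha q hq⟩
    · refine ⟨x₀, hx₀, infDist x₀ (frontier Ω) / 2, 0, 0, half_pos (hpos _ hx₀), le_rfl,
        .nil _ ⟨hx₀, half_lt_self (hpos _ hx₀)⟩⟩
    · rintro x ⟨hxc, hx⟩
      have hd := hpos x hx
      obtain ⟨a, ha, hxa⟩ := Metric.mem_closure_iff.1 hxc (infDist x (frontier Ω) / 4)
        (by positivity)
      apply hext a ha
      have := infDist_le_infDist_add_dist (s := frontier Ω) (x := x) (y := a)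
      linarith
  have hK : IsCompact (closure Ω ∩ {x | η ≤ infDist x (frontier Ω)}) := by
    apply Metric.isCompact_of_isClosed_isBounded
    · exact isClosed_closure.inter (isClosed_le continuous_const (continuous_infDist_pt _))
    · exact hΩb.closure.subset inter_subset_left
  have hKΩ : ∀ x ∈ closure Ω ∩ {x | η ≤ infDist x (frontier Ω)}, x ∈ Ω := by
    rintro x ⟨hx, hx2⟩
    by_contra hxΩ
    have : x ∈ frontier Ω := by
      rw [hΩo.frontier_eq]
      exact ⟨hx, hxΩ⟩
    have h0 := infDist_zero_of_mem this
    have hx3 : η ≤ infDist x (frontier Ω) := hx2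
    linarith
  have main := hK.induction_on (p := fun s => ∃ m D : ℝ, ∃ n : ℕ, 0 < m ∧ 0 ≤ D ∧ ∀ x ∈ s,
    SegChain (innerSet Ω m) D n x₀ x) ⟨1, 0, 0, one_pos, le_rfl, by simp⟩
    (by
      rintro s t hst ⟨m, D, n, hm, hD, h⟩
      exact ⟨m, D, n, hm, hD, fun x hx => h x (hst hx)⟩)
    (by
      rintro s t ⟨m, D, n, hm, hD, h⟩ ⟨m', D', n', hm', hD', h'⟩
      have hDD : 0 ≤ max D D' := le_max_of_le_left hD
      have m1 := min_le_left m m'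
      have m2 := min_le_right m m'
      refine ⟨min m m', max D D', max n n', lt_min hm hm', hDD, ?_⟩
      rintro x (hx | hx)
      · exact ((h x hx).mono (aux_anti (by assumption)) (le_max_left _ _)).pad hDD
          (le_max_left _ _)
      · exact ((h' x hx).mono (aux_anti (by assumption)) (le_max_right _ _)).pad hDD
          (le_max_right _ _))
    (by
      intro x hx
      have hxΩ := hKΩ x hx
      obtain ⟨m, D, n, hm, hD, h⟩ := hsub hxΩ
      obtain ⟨m', D', n', hm', hD', h'⟩ := aux_extend hm hD h
      exact ⟨ball x (infDist x (frontier Ω) / 2),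
        mem_nhdsWithin_of_mem_nhds (ball_mem_nhds _ (half_pos (hpos x hxΩ))),
        m', D', n', hm', hD', fun q hq => h' q hq⟩)
  obtain ⟨m, D, n, hm, hD, h⟩ := main
  exact ⟨x₀, m, D, n, hm, hD, fun x hx hxη => h x ⟨subset_closure hx, hxη⟩⟩

/-- Geometry of the inner parallel sets of a `C²` domain,
Lemma 3.2 of the paper. -/
theorem stmt8 {N : ℕ} (hN : 1 ≤ N) (Ω : Set (Euc N))
    (hΩo : IsOpen Ω) (hΩb : Bornology.IsBounded Ω) (hΩc : IsConnected Ω)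
    (hΩ2 : HasC2Boundary Ω) :
    ∃ δ₀ > (0 : ℝ),
      (∀ δ : ℝ, 0 ≤ δ → δ ≤ δ₀ →
        IsConnected (innerSet Ω δ) ∧
        ∀ x ∈ innerSet Ω δ, ∀ y ∈ innerSet Ω δ,
          ∃ γ : ℝ → Euc N, IsPWC1Path γ ∧ γ 0 = x ∧ γ 1 = y ∧
            Set.MapsTo γ (Set.Icc 0 1) (closure (innerSet Ω δ))) ∧
      (∃ C_Ω > (0 : ℝ), ∀ δ : ℝ, 0 ≤ δ → δ ≤ δ₀ →
        ∀ x ∈ innerSet Ω δ, ∀ y ∈ innerSet Ω δ, dTilde (innerSet Ω δ) x y ≤ C_Ω) ∧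
      (∃ δbar > (0 : ℝ), ∃ Kbar > (0 : ℝ), ∀ δ : ℝ, 0 ≤ δ → δ ≤ δ₀ →
        ∀ x ∈ innerSet Ω δ, ∀ y ∈ innerSet Ω δ, ‖x - y‖ ≤ δbar →
          dTilde (innerSet Ω δ) x y ≤ Kbar * ‖x - y‖) := by
  have hNe : Nonempty (Fin N) := ⟨⟨0, hN⟩⟩
  have hfne : (frontier Ω).Nonempty := by
    rw [nonempty_frontier_iff]
    refine ⟨hΩc.nonempty, fun h => ?_⟩
    rw [h] at hΩb
    exact NormedSpace.unbounded_univ ℝ (Euc N) hΩb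
  obtain ⟨r, hr, c, hc, hc1, hpush⟩ := aux_push_unif hΩo hΩb hfne hΩ2
  set η := c * r with hη
  have hηpos : 0 < η := by positivity
  have hηr : η ≤ r := by nlinarith
  obtain ⟨x₀, m₀, D₀, n₀, hm₀, hD₀, hall⟩ :=
    aux_global hΩo hΩb hΩc hfne hηpos
  set δ₀ := min m₀ (η / 2) with hδ₀
  have hδ₀m : δ₀ ≤ m₀ := min_le_left _ _
  have hδ₀η : δ₀ ≤ η / 2 := min_le_right _ _
  -- every point of the inner set is joined to x₀
  have hjoin : ∀ δ : ℝ, 0 ≤ δ → δ ≤ δ₀ → ∀ x ∈ innerSet Ω δ,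
      SegChain (innerSet Ω δ) (max D₀ r) (n₀ + 1) x₀ x := by
    intro δ hδ0 hδ x hx
    have hsub : innerSet Ω m₀ ⊆ innerSet Ω δ := fun z hz => ⟨hz.1, by linarith [hz.2]⟩
    have hD' : 0 ≤ max D₀ r := le_max_of_le_left hD₀
    by_cases hxη : η ≤ infDist x (frontier Ω)
    · exact ((hall x hx.1 hxη).mono hsub (le_max_left _ _)).pad hD' (Nat.le_succ _)
    · push Not at hxη
      obtain ⟨v, hv, H⟩ := hpush x (by linarith)
      have Hx := H x hx.1 (by simpa using hr)
      have h1 := Hx r hr.le le_rfl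
      refine ((hall _ h1.1 ?_).mono hsub (le_max_left _ _)).trans
        (SegChain.single ?_ ?_)
      · linarith [h1.2, infDist_nonneg (x := x) (s := frontier Ω)]
      · rw [segment_symm]
        exact aux_seg hc.le hx hr.le Hx
      · refine le_trans ?_ (le_max_right _ _)
        rw [dist_eq_norm, add_sub_cancel_left, norm_smul, Real.norm_of_nonneg hr.le]
        nlinarith
  have hpair : ∀ δ : ℝ, 0 ≤ δ → δ ≤ δ₀ → ∀ x ∈ innerSet Ω δ, ∀ y ∈ innerSet Ω δ,
      SegChain (innerSet Ω δ) (max D₀ r) ((n₀ + 1) + (n₀ + 1)) x y :=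
    fun δ h0 h1 x hx y hy => (hjoin δ h0 h1 x hx).symm.trans (hjoin δ h0 h1 y hy)
  have hD' : 0 ≤ max D₀ r := le_max_of_le_left hD₀
  have hD'' : 0 < max D₀ r := lt_max_of_lt_right hr
  refine ⟨δ₀, lt_min hm₀ (by positivity), ?_, ?_, ?_⟩
  · intro δ h0 h1
    refine ⟨?_, ?_⟩
    · -- nonempty: start from any point of Ω
      have hx₀ : x₀ ∈ innerSet Ω δ := by
        obtain ⟨z, hz⟩ := hΩc.nonempty
        have hz' : z ∈ innerSet Ω 0 := by
          refine ⟨hz, ?_⟩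
          have hcl : IsClosed (frontier Ω) := isClosed_frontier
          rw [← hcl.notMem_iff_infDist_pos hfne, hΩo.frontier_eq]
          exact fun h => h.2 hz
        by_cases hzη : η ≤ infDist z (frontier Ω)
        · have := (hall z hz hzη).left_mem
          exact ⟨this.1, by linarith [this.2]⟩
        · push Not at hzη
          obtain ⟨v, hv, H⟩ := hpush z (by linarith)
          have h2 := H z hz (by simpa using hr) r hr.le le_rfl
          have := (hall _ h2.1 (by linarith [h2.2, hz'.2])).left_mem
          exact ⟨this.1, by linarith [this.2]⟩
      exact IsPathConnected.isConnected ⟨x₀, hx₀, fun {y} hy => (hjoin δ h0 h1 y hy).joinedIn⟩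
    · intro x hx y hy
      obtain ⟨γ, g1, g2, g3, g4, -⟩ := (hpair δ h0 h1 x hx y hy).exists_path hD'
      exact ⟨γ, g1, g2, g3, fun t ht => subset_closure (g4 ht)⟩
  · exact ⟨2 ^ ((n₀ + 1) + (n₀ + 1)) * max D₀ r, by positivity,
      fun δ h0 h1 x hx y hy => (hpair δ h0 h1 x hx y hy).dTilde_le hD'⟩
  · refine ⟨η / 4, by positivity, 8 / c, by positivity, ?_⟩
    intro δ h0 h1 x hx y hy hxy
    set h := ‖x - y‖ with hh
    have hh0 : 0 ≤ h := norm_nonneg _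
    have hdist : dist x y = h := dist_eq_norm _ _
    have hhc : h ≤ h / c := by
      rw [le_div_iff₀ hc]
      nlinarith
    have hch : SegChain (innerSet Ω δ) (h / c) 3 x y := by
      by_cases hxη : η ≤ infDist x (frontier Ω)
      · refine (SegChain.single ?_ (hdist.le.trans hhc)).pad (by positivity) (by norm_num)
        intro q hq
        refine aux_near hx.1 (h := h) h0 (by linarith) ?_
        have := segment_subset_closedBall_left x y hq
        rwa [mem_closedBall, hdist] at this
      · push Not at hxη
        obtain ⟨v, hv, H⟩ := hpush x (by linarith)
        have Hx := H x hx.1 (by simpa using hr)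
        have Hy := H y hy.1 (by rw [dist_comm, hdist]; linarith)
        have ht0 : 0 ≤ h / c := by positivity
        have htr : h / c ≤ r := by
          rw [div_le_iff₀ hc]
          linarith
        have hlen : ∀ z : Euc N, dist z (z + (h / c) • v) ≤ h / c := by
          intro z
          rw [dist_comm, dist_eq_norm, add_sub_cancel_left, norm_smul, Real.norm_of_nonneg ht0]
          nlinarith
        have c1 : SegChain (innerSet Ω δ) (h / c) 1 x (x + (h / c) • v) :=
          SegChain.single (aux_seg hc.le hx ht0 fun t a b => Hx t a (b.trans htr)) (hlen x)
        have c3 : SegChain (innerSet Ω δ) (h / c) 1 (y + (h / c) • v) y :=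
          (SegChain.single (aux_seg hc.le hy ht0 fun t a b => Hy t a (b.trans htr)) (hlen y)).symm
        have hd2 : dist (x + (h / c) • v) (y + (h / c) • v) = h := by
          rw [dist_add_right, hdist]
        have c2 : SegChain (innerSet Ω δ) (h / c) 1 (x + (h / c) • v) (y + (h / c) • v) := by
          refine SegChain.single ?_ (hd2.le.trans hhc)
          intro q hq
          have hX := Hx (h / c) ht0 htr
          refine aux_near hX.1 (h := h) h0 ?_ ?_
          · have e : c * (h / c) = h := by field_simp
            linarith [hX.2, hx.2]
          · have := segment_subset_closedBall_left _ _ hq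
            rwa [mem_closedBall, hd2] at this
        exact (c1.trans c2).trans c3
    refine (hch.dTilde_le (by positivity)).trans (le_of_eq ?_)
    ring
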